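/- Let ω̄ ∈ Ω and t ∈ I, and assume W_s(ω) ≠ ∅ for every ω ∈ Ω and every s = t,…,T. Then for every x ∈ W_t(ω̄) there exist Q ∈ 𝒫(ω̄) and a process (ξ_s)_{s=t,…,T} with ξ_s ∈ L(F_s;V_s) for every s = t,…,T, such that ξ_t(ω̄) = x and E_Q[ξ_{s+1}|F_s](ω) − ξ_s(ω) ∈ C_s(ω) for every s = t,…,T−1 and every ω ∈ supp Q. -/

import Mathlib

open Set MeasureTheory Pointwise

namespace MSPPaper

section Defs

variable {Ω E : Type*}

/-- A finitely supported probability measure on `Ω`: finite support, strictly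
positive weights on the support, total mass one. -/
structure FinProb (Ω : Type*) where
  supp : Finset Ω
  w : Ω → ℝ
  pos : ∀ ω ∈ supp, 0 < w ω
  zero : ∀ ω ∉ supp, w ω = 0
  sum_one : ∑ ω ∈ supp, w ω = 1

/-- The measure of a set under a finitely supported probability. -/
noncomputable def FinProb.meas (Q : FinProb Ω) (A : Set Ω) : ℝ :=
  letI := Classical.decPred fun ω => ω ∈ A
  ∑ ω ∈ Q.supp.filter (fun ω => ω ∈ A), Q.w ω

/-- The level set `Σ_t^ω` of the process `ψ`. -/
def level (ψ : ℕ → Ω → E) (t : ℕ) (ω : Ω) : Set Ω :=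
  {ω' | ∀ s ≤ t, ψ s ω' = ψ s ω}

/-- The conditional expectation `E_Q[ξ | F_t](ω)`. -/
noncomputable def condExp {F : Type*} [AddCommMonoid F] [Module ℝ F]
    (ψ : ℕ → Ω → E) (t : ℕ) (Q : FinProb Ω) (ξ : Ω → F) (ω : Ω) : F :=
  letI := Classical.decPred fun ω' => ω' ∈ level ψ t ω
  (Q.meas (level ψ t ω))⁻¹ •
    ∑ ω' ∈ Q.supp.filter (fun ω' => ω' ∈ level ψ t ω), Q.w ω' • ξ ω'

variable [MeasurableSpace E]

/-- The natural filtration `F̂_t` generated by `ψ_0, …, ψ_t`. -/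
def natFilt (ψ : ℕ → Ω → E) (t : ℕ) : MeasurableSpace Ω :=
  ⨆ s ∈ Finset.range (t + 1), MeasurableSpace.comap (ψ s) inferInstance

/-- The `P`-null sets relative to `F̂_t`. -/
def nullSets (ψ : ℕ → Ω → E) (P : FinProb Ω) (t : ℕ) : Set (Set Ω) :=
  {A | ∃ A', A ⊆ A' ∧ MeasurableSet[natFilt ψ t] A' ∧ P.meas A' = 0}

/-- The completed filtration `F_t`. -/
def filt (ψ : ℕ → Ω → E) (t : ℕ) : MeasurableSpace Ω :=
  ⨅ P : FinProb Ω,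
    MeasurableSpace.generateFrom ({A | MeasurableSet[natFilt ψ t] A} ∪ nullSets ψ P t)

/-- `G`-measurability of a correspondence. -/
def CorrMeasurable {F : Type*} [TopologicalSpace F]
    (G : MeasurableSpace Ω) (U : Ω → Set F) : Prop :=
  ∀ O : Set F, IsOpen O → MeasurableSet[G] {ω | (U ω ∩ O).Nonempty}

/-- The set `L(G; U)` of `G`-measurable selections of `U`. -/
def Selections {F : Type*} [MeasurableSpace F]
    (G : MeasurableSpace Ω) (U : Ω → Set F) : Set (Ω → F) :=
  {ξ | Measurable[G] ξ ∧ ∀ ω, ξ ω ∈ U ω}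

/-- The correspondence `U^♯` (taken at stage `t`). -/
def sharp {d : ℕ} (ψ : ℕ → Ω → E) (t : ℕ) (U : Ω → Set (Fin d → ℝ)) (ω : Ω) :
    Set (Fin d → ℝ) :=
  convexHull ℝ (⋃ ω' ∈ level ψ t ω, U ω')

/-- The correspondence `U^♭` (taken at stage `t`). -/
def flat {d : ℕ} (ψ : ℕ → Ω → E) (t : ℕ) (U : Ω → Set (Fin d → ℝ)) (ω : Ω) :
    Set (Fin d → ℝ) :=
  ⋂ ω' ∈ level ψ t ω, ⋃ l ∈ Ioo (0 : ℝ) 1, (l • U ω' + (1 - l) • sharp ψ t U ω)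

/-- The backward iteration defining `W`, indexed from the terminal date. -/
def Wrev {d : ℕ} (ψ : ℕ → Ω → E) (T : ℕ) (V C : ℕ → Ω → Set (Fin d → ℝ)) :
    ℕ → Ω → Set (Fin d → ℝ)
  | 0 => V T
  | (k + 1) => fun ω =>
      V (T - (k + 1)) ω ∩
        (flat ψ (T - (k + 1)) (Wrev ψ T V C k) ω - C (T - (k + 1)) ω)

/-- The sequence `W_t`: `W_T = V_T` and `W_t = V_t ∩ (W_{t+1}^♭ − C_t)` for `t < T`. -/
def W {d : ℕ} (ψ : ℕ → Ω → E) (T : ℕ) (V C : ℕ → Ω → Set (Fin d → ℝ)) (t : ℕ) :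
    Ω → Set (Fin d → ℝ) :=
  Wrev ψ T V C (T - t)

/-- The defining hypotheses of a martingale selection problem `(V, C)`:
adapted measurable correspondences, `V_t(ω)` convex and relatively open,
`C_t(ω)` closed and convex. -/
def IsMSP {d : ℕ} (ψ : ℕ → Ω → E) (T : ℕ) (V C : ℕ → Ω → Set (Fin d → ℝ)) : Prop :=
  ∀ t ≤ T,
    CorrMeasurable (filt ψ t) (V t) ∧ CorrMeasurable (filt ψ t) (C t) ∧
    ∀ ω : Ω, Convex ℝ (V t ω) ∧ V t ω = intrinsicInterior ℝ (V t ω) ∧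
      IsClosed (C t ω) ∧ Convex ℝ (C t ω)

/-- `(ξ, Q)` is a solution of the martingale selection problem `(V, C)`. -/
def IsSolution {d : ℕ} (ψ : ℕ → Ω → E) (T : ℕ) (V C : ℕ → Ω → Set (Fin d → ℝ))
    (ξ : ℕ → Ω → (Fin d → ℝ)) (Q : FinProb Ω) : Prop :=
  (∀ t ≤ T, ξ t ∈ Selections (filt ψ t) (V t)) ∧
  (∀ t, t + 1 ≤ T → ∀ ω ∈ Q.supp, condExp ψ t Q (ξ (t + 1)) ω - ξ t ω ∈ C t ω)

/-- Solvability of the martingale selection problem: a local solution exists at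
every point of `Ω`. -/
def Solvable {d : ℕ} (ψ : ℕ → Ω → E) (T : ℕ) (V C : ℕ → Ω → Set (Fin d → ℝ)) : Prop :=
  ∀ ωb : Ω, ∃ (ξ : ℕ → Ω → (Fin d → ℝ)) (Q : FinProb Ω),
    ωb ∈ Q.supp ∧ IsSolution ψ T V C ξ Q

/-- The positive polar cone of a subset of `ℝ^d`. -/
def polar {d : ℕ} (B : Set (Fin d → ℝ)) : Set (Fin d → ℝ) :=
  {y | ∀ x ∈ B, 0 ≤ ∑ i, y i * x i}

/-- A closed convex cone (containing the origin). -/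
def IsClosedConvexCone {F : Type*} [TopologicalSpace F] [AddCommMonoid F] [Module ℝ F]
    (A : Set F) : Prop :=
  IsClosed A ∧ Convex ℝ A ∧ (0 : F) ∈ A ∧ ∀ c : ℝ, 0 < c → ∀ x ∈ A, c • x ∈ A

end Defs

section LevelSets

variable {Ω E : Type*}

theorem mem_level_self (ψ : ℕ → Ω → E) (t : ℕ) (ω : Ω) : ω ∈ level ψ t ω := fun _ _ => rfl

theorem level_eq_of_mem {ψ : ℕ → Ω → E} {t : ℕ} {ω ω' : Ω} (h : ω' ∈ level ψ t ω) :
    level ψ t ω' = level ψ t ω := by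
  ext η
  exact forall₂_congr fun s hs => by rw [h s hs]

theorem mem_level_comm {ψ : ℕ → Ω → E} {t : ℕ} {ω ω' : Ω} :
    ω' ∈ level ψ t ω ↔ ω ∈ level ψ t ω' :=
  ⟨fun h s hs => (h s hs).symm, fun h s hs => (h s hs).symm⟩

theorem level_anti (ψ : ℕ → Ω → E) {s t : ℕ} (h : s ≤ t) (ω : Ω) :
    level ψ t ω ⊆ level ψ s ω :=
  fun _ hω r hr => hω r (hr.trans h)

/-- A map that is constant on the level sets of `ψ` at stage `t`. -/
def LevelConst {β : Type*} (ψ : ℕ → Ω → E) (t : ℕ) (f : Ω → β) : Prop :=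
  ∀ ω, ∀ ω' ∈ level ψ t ω, f ω' = f ω

/-- A choice of a representative in each level set at stage `t` that chooses `ωb` in its own
level set. -/
theorem exists_level_representative (ψ : ℕ → Ω → E) (t : ℕ) (ωb : Ω) :
    ∃ r : Ω → Ω, LevelConst ψ t r ∧ (∀ ω, r ω ∈ level ψ t ω) ∧ r ωb = ωb := by
  classical
  let f : Set Ω → Ω := fun A => if ωb ∈ A then ωb else if h : A.Nonempty then h.some else ωb
  have hf : ∀ A : Set Ω, A.Nonempty → f A ∈ A := by
    intro A hA
    simp only [f]
    split_ifs with h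
    · exact h
    · exact hA.some_mem
  refine ⟨fun ω => f (level ψ t ω), fun ω ω' h => ?_, fun ω => hf _ ⟨ω, mem_level_self ψ t ω⟩, ?_⟩
  · simp only [level_eq_of_mem h]
  · simp [f, mem_level_self]

/-- A level-constant correspondence with nonempty values has a level-constant selection with a
prescribed value at one point. -/
theorem exists_level_selection {F : Type*} [Inhabited F] {ψ : ℕ → Ω → E} {t : ℕ} {U : Ω → Set F}
    (hU : LevelConst ψ t U) (hne : ∀ ω, (U ω).Nonempty) {ωb : Ω} {x : F} (hx : x ∈ U ωb) :
    ∃ v : Ω → F, (∀ ω, v ω ∈ U ω) ∧ LevelConst ψ t v ∧ v ωb = x := by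
  classical
  let f : Set F → F := fun A => if h : A.Nonempty then h.some else default
  have hf : ∀ A : Set F, A.Nonempty → f A ∈ A := by
    intro A hA
    simp only [f, dif_pos hA]
    exact hA.some_mem
  refine ⟨fun ω => if ωb ∈ level ψ t ω then x else f (U ω), fun ω => ?_, fun ω ω' h => ?_, ?_⟩
  · dsimp only
    split_ifs with h
    · rwa [← hU ω ωb h]
    · exact hf _ (hne ω)
  · simp only [level_eq_of_mem h, hU ω ω' h]
  · simp [mem_level_self]

end LevelSets

section FinProb

variable {Ω : Type*}

/-- The uniform probability on a nonempty finite set. -/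
noncomputable def FinProb.uniform (s : Finset Ω) (hs : s.Nonempty) : FinProb Ω where
  supp := s
  w := fun ω => letI := Classical.decPred fun ω => ω ∈ s; if ω ∈ s then (s.card : ℝ)⁻¹ else 0
  pos := fun ω hω => by
    have : 0 < s.card := hs.card_pos
    simp only [hω, if_true]
    positivity
  zero := fun ω hω => by simp [hω]
  sum_one := by
    have : (s.card : ℝ) ≠ 0 := by exact_mod_cast hs.card_pos.ne'
    rw [Finset.sum_congr rfl fun ω hω => if_pos hω]
    simp [this]

theorem FinProb.notMem_of_meas_eq_zero {Q : FinProb Ω} {A : Set Ω} (h : Q.meas A = 0) {ω : Ω}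
    (hω : ω ∈ Q.supp) : ω ∉ A := by
  classical
  intro hA
  unfold FinProb.meas at h
  rw [Finset.sum_eq_zero_iff_of_nonneg
    fun η hη => (Q.pos η (Finset.mem_filter.1 hη).1).le] at h
  exact (Q.pos ω hω).ne' (h ω (Finset.mem_filter.2 ⟨hω, hA⟩))

theorem FinProb.meas_eq_zero_of_disjoint {Q : FinProb Ω} {A : Set Ω}
    (h : ∀ ω ∈ Q.supp, ω ∉ A) : Q.meas A = 0 := by
  classical
  unfold FinProb.meas
  exact Finset.sum_eq_zero fun ω hω =>
    absurd (Finset.mem_filter.1 hω).2 (h ω (Finset.mem_filter.1 hω).1)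

variable {E F : Type*} [AddCommGroup F] [Module ℝ F] {ψ : ℕ → Ω → E} {t : ℕ}

theorem condExp_eq_sum {Q : FinProb Ω} {ω : Ω} (h : ∀ ω' ∈ Q.supp, ω' ∈ level ψ t ω)
    (ξ : Ω → F) : condExp ψ t Q ξ ω = ∑ ω' ∈ Q.supp, Q.w ω' • ξ ω' := by
  classical
  unfold condExp FinProb.meas
  rw [Finset.filter_true_of_mem h, Q.sum_one, inv_one, one_smul]

/-- The conditional expectation only depends on the restriction of the probability to the level
set, up to a factor. -/
theorem condExp_eq_of_proportional {Q Q' : FinProb Ω} {ξ ξ' : Ω → F} {ω : Ω} {c : ℝ} (hc : c ≠ 0)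
    (hsupp : ∀ ω' ∈ level ψ t ω, ω' ∈ Q.supp ↔ ω' ∈ Q'.supp)
    (hw : ∀ ω' ∈ level ψ t ω, Q.w ω' = c * Q'.w ω')
    (hξ : ∀ ω' ∈ level ψ t ω, ξ ω' = ξ' ω') :
    condExp ψ t Q ξ ω = condExp ψ t Q' ξ' ω := by
  classical
  unfold condExp FinProb.meas
  have hfilter : Q.supp.filter (fun ω' => ω' ∈ level ψ t ω) =
      Q'.supp.filter (fun ω' => ω' ∈ level ψ t ω) := by
    ext ω'
    simp only [Finset.mem_filter]
    exact and_congr_left (hsupp ω')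
  rw [hfilter, Finset.sum_congr rfl fun ω' hω' => hw ω' (Finset.mem_filter.1 hω').2,
    Finset.sum_congr rfl fun ω' hω' => (show Q.w ω' • ξ ω' = c • Q'.w ω' • ξ' ω' by
      rw [hw ω' (Finset.mem_filter.1 hω').2, hξ ω' (Finset.mem_filter.1 hω').2, mul_smul]),
    ← Finset.mul_sum, ← Finset.smul_sum, smul_smul, mul_inv, mul_right_comm, inv_mul_cancel₀ hc,
    one_mul]

end FinProb

section Filtration

variable {Ω E : Type*} [MeasurableSpace E]

/-- The σ-algebra of the sets that do not separate `ω` from `ω'`. -/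
@[reducible] def nonseparating (ω ω' : Ω) : MeasurableSpace Ω where
  MeasurableSet' A := ω ∈ A ↔ ω' ∈ A
  measurableSet_empty := by simp
  measurableSet_compl A h := by simp [h]
  measurableSet_iUnion f h := by simp [h]

theorem mem_iff_of_measurableSet_filt {ψ : ℕ → Ω → E} {t : ℕ} {A : Set Ω}
    (hA : MeasurableSet[filt ψ t] A) {ω ω' : Ω} (h : ω' ∈ level ψ t ω) : ω ∈ A ↔ ω' ∈ A := by
  classical
  have hnat : natFilt ψ t ≤ nonseparating ω ω' := by
    refine iSup₂_le fun s hs => ?_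
    rintro _ ⟨B, -, rfl⟩
    change ψ s ω ∈ B ↔ ψ s ω' ∈ B
    rw [h s (Nat.lt_succ_iff.1 (Finset.mem_range.1 hs))]
  let P : FinProb Ω := FinProb.uniform {ω, ω'} ⟨ω, by simp⟩
  have hgen : MeasurableSpace.generateFrom ({A | MeasurableSet[natFilt ψ t] A} ∪ nullSets ψ P t) ≤
      nonseparating ω ω' := by
    refine MeasurableSpace.generateFrom_le ?_
    rintro B (hB | ⟨B', hBB', -, hP⟩)
    · exact hnat B hB
    · have hω : ω ∉ B := fun hB => FinProb.notMem_of_meas_eq_zero hP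
        (by simp [P, FinProb.uniform]) (hBB' hB)
      have hω' : ω' ∉ B := fun hB => FinProb.notMem_of_meas_eq_zero hP
        (by simp [P, FinProb.uniform]) (hBB' hB)
      exact iff_of_false hω hω'
  exact hgen A (MeasurableSpace.measurableSet_iInf.1 hA P)

theorem measurableSet_level [MeasurableSingletonClass E] (ψ : ℕ → Ω → E) (t : ℕ) (ω : Ω) :
    MeasurableSet[natFilt ψ t] (level ψ t ω) := by
  have h : level ψ t ω = ⋂ s ∈ Finset.range (t + 1), ψ s ⁻¹' {ψ s ω} := by
    ext ω'
    simp [level]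
  rw [h]
  refine @Finset.measurableSet_biInter Ω ℕ (natFilt ψ t) _ _ fun s hs => ?_
  have hle : MeasurableSpace.comap (ψ s) inferInstance ≤ natFilt ψ t :=
    le_iSup₂_of_le (f := fun s (_ : s ∈ Finset.range (t + 1)) =>
      MeasurableSpace.comap (ψ s) inferInstance) s hs le_rfl
  exact hle _ ⟨_, measurableSet_singleton _, rfl⟩

theorem measurableSet_filt_of_levelConst [MeasurableSingletonClass E] {ψ : ℕ → Ω → E} {t : ℕ}
    {A : Set Ω} (hA : ∀ ω, ∀ ω' ∈ level ψ t ω, ω ∈ A → ω' ∈ A) :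
    MeasurableSet[filt ψ t] A := by
  classical
  refine MeasurableSpace.measurableSet_iInf.2 fun P => ?_
  let B : Set Ω := ⋃ ω ∈ P.supp, level ψ t ω
  let D : Set Ω := ⋃ ω ∈ P.supp.filter (fun ω => ω ∈ A), level ψ t ω
  have hB : MeasurableSet[natFilt ψ t] B :=
    @Finset.measurableSet_biUnion Ω Ω (natFilt ψ t) _ _ fun ω _ => measurableSet_level ψ t ω
  have hD : MeasurableSet[natFilt ψ t] D :=
    @Finset.measurableSet_biUnion Ω Ω (natFilt ψ t) _ _ fun ω _ => measurableSet_level ψ t ω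
  have hAD : A = D ∪ A \ B := by
    ext η
    simp only [B, D, mem_union, mem_sdiff, mem_iUnion, Finset.mem_filter, exists_prop]
    constructor
    · intro hη
      by_cases h : ∃ ω ∈ P.supp, η ∈ level ψ t ω
      · obtain ⟨ω, hω, hηω⟩ := h
        exact Or.inl ⟨ω, ⟨hω, hA η ω (mem_level_comm.1 hηω) hη⟩, hηω⟩
      · exact Or.inr ⟨hη, h⟩
    · rintro (⟨ω, ⟨-, hω⟩, hη⟩ | ⟨hη, -⟩)
      · exact hA ω η hη hω
      · exact hη
  rw [hAD]
  refine @MeasurableSet.union Ω (_) _ _ (MeasurableSpace.measurableSet_generateFrom (Or.inl hD))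
    (MeasurableSpace.measurableSet_generateFrom (Or.inr ⟨Bᶜ, fun η hη => hη.2, hB.compl, ?_⟩))
  refine FinProb.meas_eq_zero_of_disjoint fun ω hω h => h ?_
  exact mem_iUnion₂.2 ⟨ω, hω, mem_level_self ψ t ω⟩

theorem measurable_filt_of_levelConst [MeasurableSingletonClass E] {F : Type*} [MeasurableSpace F]
    {ψ : ℕ → Ω → E} {t : ℕ} {ξ : Ω → F} (hξ : LevelConst ψ t ξ) : Measurable[filt ψ t] ξ := by
  intro B _
  refine measurableSet_filt_of_levelConst fun ω ω' h hω => ?_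
  rwa [mem_preimage, hξ ω ω' h]

theorem CorrMeasurable.levelConst_closure {F : Type*} [TopologicalSpace F] {ψ : ℕ → Ω → E}
    {t : ℕ} {U : Ω → Set F} (hU : CorrMeasurable (filt ψ t) U) :
    LevelConst ψ t fun ω => closure (U ω) := by
  intro ω ω' h
  ext x
  simp only [mem_closure_iff]
  refine forall₃_congr fun O hO _ => ?_
  rw [inter_comm O, inter_comm O]
  exact (mem_iff_of_measurableSet_filt (hU O hO) h).symm

end Filtration

section Convexity

variable {F : Type*} [NormedAddCommGroup F] [NormedSpace ℝ F]

theorem affineSpan_closure_eq [FiniteDimensional ℝ F] (A : Set F) :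
    affineSpan ℝ (closure A) = affineSpan ℝ A := by
  refine le_antisymm (affineSpan_le.2 ?_) (affineSpan_mono ℝ subset_closure)
  exact closure_minimal (subset_affineSpan ℝ A) (AffineSubspace.closed_of_finiteDimensional _)

theorem isOpen_preimage_of_eq_intrinsicInterior {A : Set F} (hA : A = intrinsicInterior ℝ A)
    {L : AffineSubspace ℝ F} (hL : L = affineSpan ℝ A) : IsOpen ((↑) ⁻¹' A : Set L) := by
  subst hL
  rw [← interior_eq_iff_isOpen]
  refine subset_antisymm interior_subset fun y hy => ?_
  have hy' : (y : F) ∈ intrinsicInterior ℝ A := hA ▸ hy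
  obtain ⟨z, hz, hzy⟩ := mem_intrinsicInterior.1 hy'
  rwa [← Subtype.ext hzy]

/-- A relatively open convex set is determined by its closure. -/
theorem eq_of_closure_eq_of_relativelyOpen [FiniteDimensional ℝ F] {A B : Set F}
    (hAc : Convex ℝ A) (hBc : Convex ℝ B) (hA : A = intrinsicInterior ℝ A)
    (hB : B = intrinsicInterior ℝ B) (h : closure A = closure B) : A = B := by
  rcases A.eq_empty_or_nonempty with rfl | ⟨x, hx⟩
  · rw [closure_empty] at h
    exact (closure_empty_iff B |>.1 h.symm).symm
  let L := affineSpan ℝ A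
  have hLB : L = affineSpan ℝ B := by
    rw [← affineSpan_closure_eq B, ← h, affineSpan_closure_eq]
  have hxL : x ∈ L := subset_affineSpan ℝ A hx
  let g : L.direction → L := fun v => ⟨(v : F) +ᵥ x, L.vadd_mem_of_mem_direction v.2 hxL⟩
  let φ : L.direction → F := fun v => v + x
  have hg : Continuous g := by fun_prop
  have hφ : Topology.IsInducing φ :=
    (Homeomorph.addRight x).isInducing.comp Topology.IsInducing.subtypeVal
  have himage : ∀ S : Set F, S ⊆ L → φ '' (φ ⁻¹' S) = S := by
    intro S hS
    refine image_preimage_eq_of_subset fun y hy => ?_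
    exact ⟨⟨y -ᵥ x, L.vsub_mem_direction (hS hy) hxL⟩, by simp [φ]⟩
  have hconv : ∀ S : Set F, Convex ℝ S → Convex ℝ (φ ⁻¹' S) := by
    intro S hS
    exact (hS.translate_preimage_left x).linear_preimage L.direction.subtype
  have hAL : A ⊆ L := subset_affineSpan ℝ A
  have hBL : B ⊆ L := hLB ▸ subset_affineSpan ℝ B
  have hAo : IsOpen (φ ⁻¹' A) := (isOpen_preimage_of_eq_intrinsicInterior hA rfl).preimage hg
  have hBo : IsOpen (φ ⁻¹' B) := (isOpen_preimage_of_eq_intrinsicInterior hB hLB).preimage hg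
  have hcl : closure (φ ⁻¹' A) = closure (φ ⁻¹' B) := by
    rw [hφ.closure_eq_preimage_closure_image, hφ.closure_eq_preimage_closure_image,
      himage A hAL, himage B hBL, h]
  have hAne : (φ ⁻¹' A).Nonempty := ⟨0, by simpa [φ] using hx⟩
  have hBne : (φ ⁻¹' B).Nonempty := by
    rw [← closure_nonempty_iff, ← hcl]
    exact hAne.closure
  rw [← himage A hAL, ← himage B hBL, ← hAo.interior_eq, ← hBo.interior_eq,
    ← (hconv A hAc).interior_closure_eq_interior_of_nonempty_interior (hAo.interior_eq.symm ▸ hAne),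
    ← (hconv B hBc).interior_closure_eq_interior_of_nonempty_interior (hBo.interior_eq.symm ▸ hBne),
    hcl]

theorem convex_iUnion_combo {F : Type*} [AddCommGroup F] [Module ℝ F] {A B : Set F}
    (hA : Convex ℝ A) (hB : Convex ℝ B) :
    Convex ℝ (⋃ l ∈ Ioo (0 : ℝ) 1, (l • A + (1 - l) • B)) := by
  intro x hx y hy p q hp hq hpq
  simp only [mem_iUnion, exists_prop] at hx hy ⊢
  obtain ⟨l, ⟨hl0, hl1⟩, _, ⟨a, ha, rfl⟩, _, ⟨b, hb, rfl⟩, rfl⟩ := hx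
  obtain ⟨m, ⟨hm0, hm1⟩, _, ⟨a', ha', rfl⟩, _, ⟨b', hb', rfl⟩, rfl⟩ := hy
  have hk0 : 0 < p * l + q * m := by
    rcases hp.eq_or_lt with rfl | hp
    · have : 0 < q := by linarith
      positivity
    · positivity
  have hk1 : 0 < p * (1 - l) + q * (1 - m) := by
    have hl := sub_pos.2 hl1
    have hm := sub_pos.2 hm1
    rcases hp.eq_or_lt with rfl | hp
    · have : 0 < q := by linarith
      positivity
    · positivity
  have hk : 1 - (p * l + q * m) = p * (1 - l) + q * (1 - m) := by linear_combination -hpq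
  have combine : ∀ {S : Set F}, Convex ℝ S → ∀ {u v : F}, u ∈ S → v ∈ S → ∀ {α β : ℝ},
      0 ≤ α → 0 ≤ β → 0 < α + β → α • u + β • v ∈ (α + β) • S := by
    intro S hS u v hu hv α β hα hβ hαβ
    refine ⟨(α / (α + β)) • u + (β / (α + β)) • v, hS hu hv (by positivity) (by positivity)
      (by field_simp), ?_⟩
    simp only [smul_add, smul_smul, mul_div_cancel₀ _ hαβ.ne']
  refine ⟨p * l + q * m, ⟨hk0, by linarith⟩, ?_⟩
  rw [hk]
  refine ⟨_, combine hA ha ha' (by positivity) (by positivity) hk0, _,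
    combine hB hb hb' (mul_nonneg hp (sub_pos.2 hl1).le) (mul_nonneg hq (sub_pos.2 hm1).le) hk1, ?_⟩
  simp only [smul_add, smul_smul]
  abel

end Convexity

section Iteration

variable {Ω E : Type*} {d : ℕ} {ψ : ℕ → Ω → E}

theorem levelConst_flat (ψ : ℕ → Ω → E) (t : ℕ) (U : Ω → Set (Fin d → ℝ)) :
    LevelConst ψ t (flat ψ t U) := by
  intro ω ω' h
  simp only [flat, sharp, level_eq_of_mem h]

theorem convex_flat (t : ℕ) {U : Ω → Set (Fin d → ℝ)} (hU : ∀ ω, Convex ℝ (U ω)) (ω : Ω) :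
    Convex ℝ (flat ψ t U ω) :=
  convex_iInter₂ fun ω' _ => convex_iUnion_combo (hU ω') (convex_convexHull ℝ _)

theorem W_self (ψ : ℕ → Ω → E) (T : ℕ) (V C : ℕ → Ω → Set (Fin d → ℝ)) :
    W ψ T V C T = V T := by
  simp [W, Wrev]

theorem W_of_lt (ψ : ℕ → Ω → E) {T t : ℕ} (h : t < T) (V C : ℕ → Ω → Set (Fin d → ℝ)) (ω : Ω) :
    W ψ T V C t ω = V t ω ∩ (flat ψ t (W ψ T V C (t + 1)) ω - C t ω) := by
  obtain ⟨k, rfl⟩ := Nat.exists_eq_add_of_lt h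
  have h1 : t + k + 1 - t = k + 1 := by omega
  have h2 : t + k + 1 - (t + 1) = k := by omega
  have h3 : t + k + 1 - (k + 1) = t := by omega
  simp only [W, h1, h2, Wrev, h3]

theorem W_subset {T t : ℕ} (h : t ≤ T) (V C : ℕ → Ω → Set (Fin d → ℝ)) (ω : Ω) :
    W ψ T V C t ω ⊆ V t ω := by
  rcases h.eq_or_lt with rfl | h
  · rw [W_self]
  · rw [W_of_lt ψ h]
    exact inter_subset_left

variable [MeasurableSpace E] {T : ℕ} {V C : ℕ → Ω → Set (Fin d → ℝ)}

theorem IsMSP.levelConst_V (h : IsMSP ψ T V C) {t : ℕ} (ht : t ≤ T) : LevelConst ψ t (V t) := by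
  obtain ⟨hV, -, hp⟩ := h t ht
  intro ω ω' hω
  exact eq_of_closure_eq_of_relativelyOpen (hp ω').1 (hp ω).1 (hp ω').2.1 (hp ω).2.1
    (hV.levelConst_closure ω ω' hω)

theorem IsMSP.levelConst_C (h : IsMSP ψ T V C) {t : ℕ} (ht : t ≤ T) : LevelConst ψ t (C t) := by
  obtain ⟨-, hC, hp⟩ := h t ht
  intro ω ω' hω
  have := hC.levelConst_closure ω ω' hω
  simpa only [(hp ω').2.2.1.closure_eq, (hp ω).2.2.1.closure_eq] using this

theorem IsMSP.levelConst_W (h : IsMSP ψ T V C) {t : ℕ} (ht : t ≤ T) :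
    LevelConst ψ t (W ψ T V C t) := by
  rcases ht.eq_or_lt with rfl | hlt
  · rw [W_self]
    exact h.levelConst_V le_rfl
  · intro ω ω' hω
    rw [W_of_lt ψ hlt, W_of_lt ψ hlt, h.levelConst_V ht ω ω' hω, h.levelConst_C ht ω ω' hω,
      levelConst_flat ψ t _ ω ω' hω]

theorem IsMSP.convex_W (h : IsMSP ψ T V C) {t : ℕ} (ht : t ≤ T) (ω : Ω) :
    Convex ℝ (W ψ T V C t ω) := by
  induction ht using Nat.decreasingInduction generalizing ω with
  | self =>
    rw [W_self]
    exact ((h T le_rfl).2.2 ω).1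
  | of_succ t ht ih =>
    rw [W_of_lt ψ ht]
    exact ((h t ht.le).2.2 ω).1.inter ((convex_flat t ih ω).sub ((h t ht.le).2.2 ω).2.2.2)

end Iteration

section Representation

variable {Ω E : Type*} {d : ℕ} {ψ : ℕ → Ω → E}

/-- A point of `U^♭` is a convex combination with positive weights of points of `U` over
finitely many points of the level set, including the base point. -/
theorem exists_pos_combo_of_mem_flat {t : ℕ} {U : Ω → Set (Fin d → ℝ)} {ωb : Ω}
    {y : Fin d → ℝ} (hy : y ∈ flat ψ t U ωb) :
    ∃ (ι : Type) (_ : Fintype ι) (η : ι → Ω) (z : ι → Fin d → ℝ) (w : ι → ℝ),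
      (∀ i, η i ∈ level ψ t ωb) ∧ (∀ i, z i ∈ U (η i)) ∧ (∀ i, 0 < w i) ∧ ∑ i, w i = 1 ∧
      ∑ i, w i • z i = y ∧ ∃ i, η i = ωb := by
  have hy' := mem_iInter₂.1 hy ωb (mem_level_self ψ t ωb)
  simp only [mem_iUnion, exists_prop] at hy'
  obtain ⟨l, ⟨hl0, hl1⟩, _, ⟨a, ha, rfl⟩, _, ⟨b, hb, rfl⟩, rfl⟩ := hy'
  obtain ⟨ι, _, z, w, hz, -, hw, hw1, rfl⟩ := eq_pos_convex_span_of_mem_convexHull hb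
  have hz' : ∀ i, ∃ ω ∈ level ψ t ωb, z i ∈ U ω := fun i => by
    simpa only [mem_iUnion, exists_prop] using hz (mem_range_self i)
  choose η hη hzη using hz'
  refine ⟨Option ι, inferInstance, fun o => o.elim ωb η, fun o => o.elim a z,
    fun o => o.elim l fun i => (1 - l) * w i, ?_, ?_, ?_, ?_, ?_, none, rfl⟩
  · rintro (_ | i)
    exacts [mem_level_self ψ t ωb, hη i]
  · rintro (_ | i)
    exacts [ha, hzη i]
  · rintro (_ | i)
    exacts [hl0, mul_pos (sub_pos.2 hl1) (hw i)]
  · simp [Fintype.sum_option, ← Finset.mul_sum, hw1]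
  · simp [Fintype.sum_option, Finset.smul_sum, mul_smul]

/-- The points in the representation of an element of `U^♭` may be taken among given
representatives of the level sets at a later stage. -/
theorem exists_representative_combo_of_mem_flat {t t' : ℕ} (htt' : t ≤ t')
    {U : Ω → Set (Fin d → ℝ)} (hU : ∀ ω, Convex ℝ (U ω)) (hUc : LevelConst ψ t' U)
    (hne : ∀ ω, (U ω).Nonempty) {ωb : Ω} {r : Ω → Ω} (hr : ∀ ω, r ω ∈ level ψ t' ω)
    (hrb : r ωb = ωb) {y : Fin d → ℝ} (hy : y ∈ flat ψ t U ωb) :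
    ∃ (s : Finset Ω) (p : Ω → ℝ) (b : Ω → Fin d → ℝ),
      ωb ∈ s ∧ (∀ ω ∈ s, ω ∈ level ψ t ωb ∧ ω ∈ range r) ∧ (∀ ω ∈ s, 0 < p ω) ∧
      (∀ ω ∉ s, p ω = 0) ∧ ∑ ω ∈ s, p ω = 1 ∧ (∀ ω, b ω ∈ U ω) ∧ ∑ ω ∈ s, p ω • b ω = y := by
  classical
  obtain ⟨ι, _, η, z, w, hη, hz, hw, hw1, hwz, i₀, hi₀⟩ := exists_pos_combo_of_mem_flat hy
  let s : Finset Ω := Finset.univ.image fun i => r (η i)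
  let fiber : Ω → Finset ι := fun ω => Finset.univ.filter fun i => r (η i) = ω
  let p : Ω → ℝ := fun ω => ∑ i ∈ fiber ω, w i
  have hmaps : ∀ i ∈ (Finset.univ : Finset ι), r (η i) ∈ s :=
    fun i hi => Finset.mem_image_of_mem _ hi
  have hp : ∀ ω ∈ s, 0 < p ω := by
    intro ω hω
    obtain ⟨i, -, hi⟩ := Finset.mem_image.1 hω
    exact Finset.sum_pos (fun j _ => hw j) ⟨i, by simp [fiber, hi]⟩
  have hp0 : ∀ ω ∉ s, p ω = 0 := by
    intro ω hω
    refine Finset.sum_eq_zero fun i hi => absurd ?_ hω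
    rw [← (Finset.mem_filter.1 hi).2]
    exact hmaps i (Finset.mem_univ i)
  refine ⟨s, p, fun ω => if ω ∈ s then (fiber ω).centerMass w z else (hne ω).some,
    ?_, ?_, hp, hp0, ?_, ?_, ?_⟩
  · rw [← hrb, ← hi₀]
    exact hmaps i₀ (Finset.mem_univ i₀)
  · intro ω hω
    obtain ⟨i, -, rfl⟩ := Finset.mem_image.1 hω
    refine ⟨?_, mem_range_self _⟩
    rw [← level_eq_of_mem (hη i)]
    exact level_anti ψ htt' _ (hr _)
  · rw [← hw1]
    exact Finset.sum_fiberwise_of_maps_to hmaps w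
  · intro ω
    dsimp only
    split_ifs with hω
    · refine (hU ω).centerMass_mem (fun i _ => (hw i).le) (hp ω hω) fun i hi => ?_
      rw [← (Finset.mem_filter.1 hi).2, hUc _ _ (hr _)]
      exact hz i
    · exact (hne ω).some_mem
  · rw [← hwz, ← Finset.sum_fiberwise_of_maps_to hmaps fun i => w i • z i]
    refine Finset.sum_congr rfl fun ω hω => ?_
    dsimp only
    rw [if_pos hω, Finset.centerMass, smul_smul]
    change (p ω * (p ω)⁻¹) • _ = _
    rw [mul_inv_cancel₀ (hp ω hω).ne', one_smul]

end Representation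

section Gluing

variable {Ω E : Type*} {d : ℕ} {ψ : ℕ → Ω → E}

/-- The mixture of probabilities carried by the fibres of a map `r`. -/
theorem exists_mixture {s : Finset Ω} {p : Ω → ℝ} (hp : ∀ ω ∈ s, 0 < p ω)
    (hp0 : ∀ ω ∉ s, p ω = 0) (hp1 : ∑ ω ∈ s, p ω = 1) {r : Ω → Ω} {q : Ω → FinProb Ω}
    (hq : ∀ ω ∈ s, ∀ η ∈ (q ω).supp, r η = ω) :
    ∃ Q : FinProb Ω, (∀ η, η ∈ Q.supp ↔ r η ∈ s ∧ η ∈ (q (r η)).supp) ∧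
      (∀ η, Q.w η = p (r η) * (q (r η)).w η) ∧
      ∀ f : Ω → Fin d → ℝ, ∑ η ∈ Q.supp, Q.w η • f η =
        ∑ ω ∈ s, p ω • ∑ η ∈ (q ω).supp, (q ω).w η • f η := by
  classical
  have hmem : ∀ η, η ∈ s.biUnion (fun ω => (q ω).supp) ↔ r η ∈ s ∧ η ∈ (q (r η)).supp := by
    intro η
    rw [Finset.mem_biUnion]
    constructor
    · rintro ⟨ω, hω, hη⟩
      obtain rfl := hq ω hω η hη
      exact ⟨hω, hη⟩
    · exact fun h => ⟨_, h⟩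
  have hdisj : (s : Set Ω).PairwiseDisjoint fun ω => (q ω).supp := by
    intro ω hω ω' hω' hne
    refine Finset.disjoint_left.2 fun η hη hη' => hne ?_
    rw [← hq ω hω η hη, hq ω' hω' η hη']
  let Q : FinProb Ω :=
    { supp := s.biUnion fun ω => (q ω).supp
      w := fun η => p (r η) * (q (r η)).w η
      pos := fun η hη => mul_pos (hp _ ((hmem η).1 hη).1) ((q (r η)).pos η ((hmem η).1 hη).2)
      zero := fun η hη => by
        rw [hmem, not_and_or] at hη
        rcases hη with h | h
        · rw [hp0 _ h, zero_mul]
        · rw [(q (r η)).zero _ h, mul_zero]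
      sum_one := by
        rw [Finset.sum_biUnion hdisj, ← hp1]
        refine Finset.sum_congr rfl fun ω hω => ?_
        rw [Finset.sum_congr rfl fun η hη => (show p (r η) * (q (r η)).w η = p ω * (q ω).w η by
          rw [hq ω hω η hη]), ← Finset.mul_sum, (q ω).sum_one, mul_one] }
  refine ⟨Q, hmem, fun _ => rfl, fun f => ?_⟩
  rw [Finset.sum_biUnion hdisj]
  refine Finset.sum_congr rfl fun ω hω => ?_
  rw [Finset.smul_sum]
  refine Finset.sum_congr rfl fun η hη => ?_
  change (p (r η) * (q (r η)).w η) • f η = _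
  rw [hq ω hω η hη, mul_smul]

variable [MeasurableSpace E] {T : ℕ} {V C : ℕ → Ω → Set (Fin d → ℝ)}

theorem IsMSP.exists_levelConst_solution (h : IsMSP ψ T V C) {t : ℕ} (ht : t ≤ T)
    (hW : ∀ s, t ≤ s → s ≤ T → ∀ ω, (W ψ T V C s ω).Nonempty) (ωb : Ω) {x : Fin d → ℝ}
    (hx : x ∈ W ψ T V C t ωb) :
    ∃ (Q : FinProb Ω) (ξ : ℕ → Ω → Fin d → ℝ),
      ωb ∈ Q.supp ∧ (∀ ω ∈ Q.supp, ω ∈ level ψ t ωb) ∧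
      (∀ s, t ≤ s → s ≤ T → (∀ ω, ξ s ω ∈ V s ω) ∧ LevelConst ψ s (ξ s)) ∧ ξ t ωb = x ∧
      ∀ s, t ≤ s → s + 1 ≤ T → ∀ ω ∈ Q.supp, condExp ψ s Q (ξ (s + 1)) ω - ξ s ω ∈ C s ω := by
  classical
  induction ht using Nat.decreasingInduction generalizing ωb x with
  | self =>
    rw [W_self] at hx
    obtain ⟨v, hv, hvc, hvx⟩ := exists_level_selection (h.levelConst_V le_rfl)
      (fun ω => (hW T le_rfl le_rfl ω).mono (W_subset le_rfl V C ω)) hx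
    refine ⟨FinProb.uniform {ωb} (by simp), fun _ => v, by simp [FinProb.uniform], ?_, ?_, hvx, ?_⟩
    · intro ω hω
      obtain rfl : ω = ωb := by simpa [FinProb.uniform] using hω
      exact mem_level_self ψ T ω
    · intro s hs hsT
      obtain rfl := le_antisymm hsT hs
      exact ⟨hv, hvc⟩
    · intro s hs hsT
      omega
  | of_succ t ht ih =>
    have hW' : ∀ s, t + 1 ≤ s → s ≤ T → ∀ ω, (W ψ T V C s ω).Nonempty :=
      fun s hs => hW s (by omega)
    obtain ⟨r, hrc, hr, hrb⟩ := exists_level_representative ψ (t + 1) ωb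
    have hxV : x ∈ V t ωb := W_subset ht.le V C ωb hx
    rw [W_of_lt ψ ht] at hx
    obtain ⟨-, y, hy, c, hc, hyc⟩ := hx
    obtain ⟨s, p, b, hbs, hs, hp, hp0, hp1, hb, hpb⟩ := exists_representative_combo_of_mem_flat
      t.le_succ (h.convex_W ht) (h.levelConst_W ht) (hW (t + 1) t.le_succ ht) hr hrb hy
    choose q ζ hqmem hqlevel hζ hζb hζC using fun ω => ih hW' ω (hb ω)
    have hrs : ∀ ω ∈ s, ∀ η ∈ level ψ (t + 1) ω, r η = ω := by
      intro ω hω η hη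
      obtain ⟨ω', rfl⟩ := (hs ω hω).2
      rw [hrc _ _ hη, hrc _ _ (hr ω')]
    obtain ⟨Q, hQmem, hQw, hQsum⟩ := exists_mixture (d := d) hp hp0 hp1
      fun ω hω η hη => hrs ω hω η (hqlevel ω η hη)
    obtain ⟨v, hv, hvc, hvx⟩ := exists_level_selection (h.levelConst_V ht.le)
      (fun ω => (hW t le_rfl ht.le ω).mono (W_subset ht.le V C ω)) hxV
    have hQlevel : ∀ ω ∈ Q.supp, ω ∈ level ψ t ωb := by
      intro η hη
      obtain ⟨hrη, hη⟩ := (hQmem η).1 hη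
      rw [← level_eq_of_mem (hs _ hrη).1]
      exact level_anti ψ t.le_succ _ (hqlevel _ _ hη)
    let ξ : ℕ → Ω → Fin d → ℝ := fun u ω => if u = t then v ω else ζ (r ω) u ω
    have hξt : ξ t = v := by simp [ξ]
    have hξ : ∀ u, t + 1 ≤ u → ∀ ω, ξ u ω = ζ (r ω) u ω := fun u hu ω => if_neg (by omega)
    refine ⟨Q, ξ, (hQmem ωb).2 (by rw [hrb]; exact ⟨hbs, hqmem ωb⟩), hQlevel, ?_,
      by rw [hξt, hvx], ?_⟩
    · intro u hu huT
      rcases hu.eq_or_lt with rfl | hu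
      · rw [hξt]
        exact ⟨hv, hvc⟩
      · refine ⟨fun ω => ?_, fun ω ω' hω => ?_⟩
        · rw [hξ u hu]
          exact (hζ (r ω) u hu huT).1 ω
        · rw [hξ u hu, hξ u hu, hrc ω ω' (level_anti ψ hu ω hω)]
          exact (hζ (r ω) u hu huT).2 ω ω' hω
    · intro u hu huT ω hω
      rcases hu.eq_or_lt with rfl | hu
      · have hωl := hQlevel ω hω
        rw [condExp_eq_sum (by rwa [level_eq_of_mem hωl]), hQsum, hξt, hvc _ _ hωl, hvx,
          h.levelConst_C ht.le _ _ hωl]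
        have hy' : ∑ ω ∈ s, p ω • ∑ η ∈ (q ω).supp, (q ω).w η • ξ (t + 1) η = y := by
          rw [← hpb]
          refine Finset.sum_congr rfl fun ω hω => ?_
          rw [Finset.sum_congr rfl fun η hη => (show (q ω).w η • ξ (t + 1) η = (q ω).w η • b ω by
            rw [hξ _ le_rfl, hrs ω hω η (hqlevel ω η hη),
              (hζ ω (t + 1) le_rfl ht).2 ω η (hqlevel ω η hη), hζb]),
            ← Finset.sum_smul, (q ω).sum_one, one_smul]
        rw [hy', ← hyc, sub_sub_cancel]
        exact hc
      · obtain ⟨hrω, hωq⟩ := (hQmem ω).1 hω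
        have hrη : ∀ η ∈ level ψ u ω, r η = r ω := fun η hη => hrc ω η (level_anti ψ hu ω hη)
        rw [condExp_eq_of_proportional (hp _ hrω).ne' (Q' := q (r ω)) (ξ' := ζ (r ω) (u + 1))
          (fun η hη => by rw [hQmem, hrη η hη]; exact and_iff_right hrω)
          (fun η hη => by rw [hQw, hrη η hη])
          (fun η hη => by rw [hξ _ (by omega), hrη η hη]), hξ u hu]
        exact hζC (r ω) u hu huT ω hωq

end Gluing

/-- Lemma 4.7: extension of a point of `W_t(ω̄)` to a solution on `{t, …, T}`. -/
theorem extension_lemma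
    {Ω E : Type*}
    [TopologicalSpace Ω] [PolishSpace Ω] [MeasurableSpace Ω] [BorelSpace Ω]
    [MetricSpace E] [TopologicalSpace.SeparableSpace E] [MeasurableSpace E] [BorelSpace E]
    (ψ : ℕ → Ω → E) (hψ : ∀ t, Measurable (ψ t)) (hψ0 : ∃ e : E, ∀ ω, ψ 0 ω = e)
    (d T : ℕ) (V C : ℕ → Ω → Set (Fin d → ℝ)) (hMSP : IsMSP ψ T V C)
    (ωb : Ω) (t : ℕ) (ht : t ≤ T)
    (hW : ∀ s, t ≤ s → s ≤ T → ∀ ω : Ω, (W ψ T V C s ω).Nonempty)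
    (x : Fin d → ℝ) (hx : x ∈ W ψ T V C t ωb) :
    ∃ (Q : FinProb Ω) (ξ : ℕ → Ω → (Fin d → ℝ)),
      ωb ∈ Q.supp ∧
      (∀ s, t ≤ s → s ≤ T → ξ s ∈ Selections (filt ψ s) (V s)) ∧
      ξ t ωb = x ∧
      (∀ s, t ≤ s → s + 1 ≤ T → ∀ ω ∈ Q.supp,
        condExp ψ s Q (ξ (s + 1)) ω - ξ s ω ∈ C s ω) := by
  obtain ⟨Q, ξ, hQ, -, hξ, hξx, hC⟩ := hMSP.exists_levelConst_solution ht hW ωb hx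
  exact ⟨Q, ξ, hQ, fun s hs hsT => ⟨measurable_filt_of_levelConst (hξ s hs hsT).2,
    (hξ s hs hsT).1⟩, hξx, hC⟩

end MSPPaper
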